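/- If $A_n \geq 0$ are trace-class operators on a Hilbert space for all $n$, and $A_n \to A$ in the trace-class norm, then $\sqrt{A_n} \to \sqrt{A}$ in the Hilbert-Schmidt norm. -/

import Mathlib

open Filter Topology ContinuousLinearMap
open scoped ComplexInnerProductSpace

section Helpers

variable {H : Type*} [NormedAddCommGroup H] [InnerProductSpace ℂ H] [CompleteSpace H]

/-- For a positive (self-adjoint) `S`, `⟪x, S² x⟫ = ‖S x‖²`. -/
theorem re_inner_mul_self_of_isPositive {S : H →L[ℂ] H} (hS : S.IsPositive) (x : H) :
    (⟪x, (S * S) x⟫ : ℂ).re = ‖S x‖ ^ 2 := by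
  have h : (⟪x, S (S x)⟫ : ℂ) = ⟪S x, S x⟫ := (hS.isSymmetric x (S x)).symm
  change (⟪x, S (S x)⟫ : ℂ).re = _
  rw [h]
  exact inner_self_eq_norm_sq (𝕜 := ℂ) (S x)

/-- The operator norm of a positive operator is at most its trace. -/
theorem norm_le_trace_of_isPositive {ι : Type*} (e : HilbertBasis ι ℂ H)
    {D : H →L[ℂ] H} (hD : D.IsPositive)
    (hDtr : Summable fun i => (⟪e i, D (e i)⟫ : ℂ).re) :
    ‖D‖ ≤ ∑' i, (⟪e i, D (e i)⟫ : ℂ).re := by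
  have hD0 : 0 ≤ D := (nonneg_iff_isPositive D).2 hD
  obtain ⟨R, hR, hRD⟩ : ∃ R : H →L[ℂ] H, R.IsPositive ∧ R * R = D :=
    ⟨CFC.sqrt D, (nonneg_iff_isPositive _).1 (CFC.sqrt_nonneg D), CFC.sqrt_mul_sqrt_self D hD0⟩
  have hd : ∀ i, (⟪e i, D (e i)⟫ : ℂ).re = ‖R (e i)‖ ^ 2 := fun i => by
    rw [← hRD, re_inner_mul_self_of_isPositive hR]
  simp only [hd] at hDtr ⊢
  set t := ∑' i, ‖R (e i)‖ ^ 2 with ht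
  have ht0 : 0 ≤ t := tsum_nonneg fun i => by positivity
  have hb : ∀ x, ‖R x‖ ≤ Real.sqrt t * ‖x‖ := by
    intro x
    have h1 : HasSum (fun i => ‖(⟪e i, R x⟫ : ℂ)‖ ^ 2) (‖R x‖ ^ 2) := by
      have h := (e.hasSum_inner_mul_inner (R x) (R x)).mapL Complex.reCLM
      have h3 : Complex.reCLM (⟪R x, R x⟫ : ℂ) = ‖R x‖ ^ 2 :=
        inner_self_eq_norm_sq (𝕜 := ℂ) (R x)
      rw [h3] at h
      have h6 : (fun i => ‖(⟪e i, R x⟫ : ℂ)‖ ^ 2) =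
          fun i => Complex.reCLM ((⟪R x, e i⟫ : ℂ) * ⟪e i, R x⟫) := by
        funext i
        rw [← inner_conj_symm (R x) (e i), ← Complex.normSq_eq_conj_mul_self,
          Complex.normSq_eq_norm_sq, Complex.reCLM_apply, Complex.ofReal_re]
      rw [h6]
      exact h
    have h2 : ‖R x‖ ^ 2 ≤ t * ‖x‖ ^ 2 := by
      rw [← h1.tsum_eq, ht, ← tsum_mul_right]
      refine h1.summable.tsum_le_tsum (fun i => ?_) (hDtr.mul_right _)
      have h4 : (⟪e i, R x⟫ : ℂ) = ⟪R (e i), x⟫ := (hR.isSymmetric (e i) x).symm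
      rw [h4, ← mul_pow]
      gcongr
      exact norm_inner_le_norm _ _
    have h5 : ‖R x‖ ^ 2 ≤ (Real.sqrt t * ‖x‖) ^ 2 := by
      rwa [mul_pow, Real.sq_sqrt ht0]
    exact le_of_sq_le_sq h5 (by positivity)
  have hn : ‖R‖ ≤ Real.sqrt t := R.opNorm_le_bound (Real.sqrt_nonneg _) hb
  calc ‖D‖ = ‖R * R‖ := by rw [hRD]
    _ ≤ ‖R‖ * ‖R‖ := norm_mul_le _ _
    _ ≤ Real.sqrt t * Real.sqrt t := by gcongr
    _ = t := Real.mul_self_sqrt ht0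

/-- If `D ≥ 0`, `D² = K²` with `K` self-adjoint, then `D = |K|`. -/
theorem eq_abs_of_mul_self_eq {D K : H →L[ℂ] H} (hD : D.IsPositive) (hK : IsSelfAdjoint K)
    (h : D * D = K * K) : CFC.abs K = D := by
  have hD0 : 0 ≤ D := (nonneg_iff_isPositive D).2 hD
  rw [CFC.abs, hK.star_eq, ← h]
  exact CFC.sqrt_mul_self D hD0

theorem re_inner_le_of_mul_self_eq {D K : H →L[ℂ] H} (hD : D.IsPositive) (hK : IsSelfAdjoint K)
    (h : D * D = K * K) (x : H) : (⟪x, K x⟫ : ℂ).re ≤ (⟪x, D x⟫ : ℂ).re := by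
  have h1 : 0 ≤ D - K := by
    rw [← eq_abs_of_mul_self_eq hD hK h, CFC.abs_sub_self K hK]
    exact nsmul_nonneg (CFC.negPart_nonneg K) 2
  have h2 := ((nonneg_iff_isPositive _).1 h1).re_inner_nonneg_right x
  simp only [sub_apply, inner_sub_right, map_sub] at h2
  simpa using h2

end Helpers

/-- If `Aₙ ≥ 0` are trace-class operators on a Hilbert space and `Aₙ → A` in the
trace-class norm, then `√Aₙ → √A` in the Hilbert-Schmidt norm.  Here the square roots `S n`
(resp. `Slim`) are the (unique) positive square roots of `A n` (resp. `Alim`), the operators `D n`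
are the absolute values `|A n - Alim|` (positive operators with `(D n)² = (A n - Alim)²`), the
trace-class norm of `A n - Alim` is `∑ᵢ ⟪eᵢ, D n eᵢ⟫` and the Hilbert-Schmidt norm of `T` is
`(∑ᵢ ‖T eᵢ‖²)^{1/2}`, computed in any Hilbert basis `e`. -/
theorem sqrt_continuous_traceClass_to_hilbertSchmidt
    {H : Type*} [NormedAddCommGroup H] [InnerProductSpace ℂ H] [CompleteSpace H]
    {ι : Type*} (e : HilbertBasis ι ℂ H)
    (A : ℕ → H →L[ℂ] H) (Alim : H →L[ℂ] H)
    (hA : ∀ n, (A n).IsPositive) (hAlim : Alim.IsPositive)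
    (hAtr : ∀ n, Summable fun i => (⟪e i, A n (e i)⟫ : ℂ).re)
    (hAlimtr : Summable fun i => (⟪e i, Alim (e i)⟫ : ℂ).re)
    (D : ℕ → H →L[ℂ] H)
    (hD : ∀ n, (D n).IsPositive)
    (hD2 : ∀ n, D n * D n = (A n - Alim) * (A n - Alim))
    (hDtr : ∀ n, Summable fun i => (⟪e i, D n (e i)⟫ : ℂ).re)
    (S : ℕ → H →L[ℂ] H) (Slim : H →L[ℂ] H)
    (hS : ∀ n, (S n).IsPositive) (hS2 : ∀ n, S n * S n = A n)
    (hSlim : Slim.IsPositive) (hSlim2 : Slim * Slim = Alim)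
    (hconv : Tendsto (fun n => ∑' i, (⟪e i, D n (e i)⟫ : ℂ).re) atTop (𝓝 0)) :
    Tendsto (fun n => Real.sqrt (∑' i, ‖(S n - Slim) (e i)‖ ^ 2)) atTop (𝓝 0) := by
  have hK : ∀ n, IsSelfAdjoint (A n - Alim) := fun n =>
    (hA n).isSelfAdjoint.sub hAlim.isSelfAdjoint
  have hnorm : ∀ n, ‖A n - Alim‖ ≤ ∑' i, (⟪e i, D n (e i)⟫ : ℂ).re := fun n => by
    rw [← CFC.norm_abs, eq_abs_of_mul_self_eq (hD n) (hK n) (hD2 n)]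
    exact norm_le_trace_of_isPositive e (hD n) (hDtr n)
  have hAconv : Tendsto A atTop (𝓝 Alim) :=
    tendsto_iff_norm_sub_tendsto_zero.2
      (squeeze_zero (fun n => norm_nonneg _) hnorm hconv)
  have hSconv : Tendsto S atTop (𝓝 Slim) := by
    have h1 := (CFC.continuousOn_sqrt (A := H →L[ℂ] H)) Alim
      ((nonneg_iff_isPositive _).2 hAlim)
    have h2 : Tendsto (fun n => CFC.sqrt (A n)) atTop (𝓝 (CFC.sqrt Alim)) :=
      h1.tendsto.comp (tendsto_nhdsWithin_iff.2
        ⟨hAconv, Eventually.of_forall fun n => (nonneg_iff_isPositive _).2 (hA n)⟩)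
    have h3 : ∀ n, CFC.sqrt (A n) = S n := fun n =>
      CFC.sqrt_unique (hS2 n) ((nonneg_iff_isPositive _).2 (hS n))
    have h4 : CFC.sqrt Alim = Slim :=
      CFC.sqrt_unique hSlim2 ((nonneg_iff_isPositive _).2 hSlim)
    simpa only [h3, h4] using h2
  set d : ℕ → ι → ℝ := fun n i => (⟪e i, D n (e i)⟫ : ℂ).re with hd
  have hd0 : ∀ n i, 0 ≤ d n i := fun n i => (hD n).re_inner_nonneg_right (e i)
  set a : ℕ → ι → ℝ := fun n i => ‖(S n - Slim) (e i)‖ ^ 2 with ha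
  have ha0 : ∀ n i, 0 ≤ a n i := fun n i => by positivity
  have hsl : ∀ i, (⟪e i, Alim (e i)⟫ : ℂ).re = ‖Slim (e i)‖ ^ 2 := fun i => by
    rw [← hSlim2, re_inner_mul_self_of_isPositive hSlim]
  have hsn : ∀ n i, (⟪e i, A n (e i)⟫ : ℂ).re = ‖S n (e i)‖ ^ 2 := fun n i => by
    rw [← hS2 n, re_inner_mul_self_of_isPositive (hS n)]
  have hbound : ∀ n i, a n i - 2 * d n i ≤ 4 * ‖Slim (e i)‖ ^ 2 := by
    intro n i
    have h1 := re_inner_le_of_mul_self_eq (hD n) (hK n) (hD2 n) (e i)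
    rw [sub_apply, inner_sub_right, Complex.sub_re, hsl, hsn] at h1
    have h2 : ‖(S n - Slim) (e i)‖ ≤ ‖S n (e i)‖ + ‖Slim (e i)‖ := norm_sub_le _ _
    have h3 : a n i ≤ (‖S n (e i)‖ + ‖Slim (e i)‖) ^ 2 := by
      simp only [ha]; gcongr
    have h4 : ‖S n (e i)‖ ^ 2 - ‖Slim (e i)‖ ^ 2 ≤ d n i := h1
    nlinarith [sq_nonneg (‖S n (e i)‖ - ‖Slim (e i)‖)]
  have hsum : Summable fun i => 4 * ‖Slim (e i)‖ ^ 2 := by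
    simp only [hsl] at hAlimtr
    exact hAlimtr.mul_left 4
  have hmb : ∀ n i, ‖max (a n i - 2 * d n i) 0‖ ≤ 4 * ‖Slim (e i)‖ ^ 2 := fun n i => by
    rw [Real.norm_of_nonneg (le_max_right _ _)]
    exact max_le (hbound n i) (by positivity)
  have hpt : ∀ i, Tendsto (fun n => max (a n i - 2 * d n i) 0) atTop (𝓝 0) := by
    intro i
    have h1 : Tendsto (fun n => a n i) atTop (𝓝 0) := by
      have h2 : Tendsto (fun n => (S n - Slim) (e i)) atTop (𝓝 ((Slim - Slim) (e i))) :=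
        ((ContinuousLinearMap.apply ℂ H (e i)).continuous.tendsto _).comp
          (hSconv.sub_const Slim)
      simpa [ha] using h2.norm.pow 2
    exact squeeze_zero (fun n => le_max_right _ _)
      (fun n => max_le (by linarith [hd0 n i]) (ha0 n i)) h1
  have hT : Tendsto (fun n => ∑' i, max (a n i - 2 * d n i) 0) atTop (𝓝 0) := by
    have h := tendsto_tsum_of_dominated_convergence hsum hpt
      (Eventually.of_forall fun n i => hmb n i)
    simpa using h
  have hfin : Tendsto (fun n => ∑' i, a n i) atTop (𝓝 0) := by
    have hU : Tendsto (fun n => (∑' i, max (a n i - 2 * d n i) 0) + 2 * ∑' i, d n i)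
        atTop (𝓝 0) := by
      simpa using hT.add (hconv.const_mul 2)
    refine squeeze_zero (fun n => tsum_nonneg (ha0 n)) (fun n => ?_) hU
    have hm : Summable fun i => max (a n i - 2 * d n i) 0 :=
      Summable.of_norm_bounded hsum (hmb n)
    have h2d : Summable fun i => 2 * d n i := (hDtr n).mul_left 2
    have hle : ∀ i, a n i ≤ max (a n i - 2 * d n i) 0 + 2 * d n i := fun i => by
      linarith [le_max_left (a n i - 2 * d n i) 0]
    have has : Summable (a n) := Summable.of_nonneg_of_le (ha0 n) hle (hm.add h2d)
    rw [← tsum_mul_left, ← hm.tsum_add h2d]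
    exact has.tsum_le_tsum hle (hm.add h2d)
  have hres := hfin.sqrt
  rw [Real.sqrt_zero] at hres
  exact hres
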